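/- Let R be a (not necessarily commutative) ℤ-graded ring, T and F graded right R-modules, and E a graded injective envelope of F. Then Hombar(T,E) = 0 (for every d ∈ ℤ, every degree-d R-linear map T → E is zero) if and only if for every homogeneous t ∈ T and every nonzero homogeneous f ∈ F, there exists a homogeneous r ∈ R such that t·r = 0 and f·r ≠ 0. -/

import Mathlib

/-!
STATEMENT 3: For a ℤ-graded ring `R`, graded right `R`-modules `T`, `F` and a graded
injective envelope `E` of `F` (encoded by realizing `F` as a graded essential submodule
of the graded-injective module `E`), one has `Hombar(T, E) = 0` (every map of any degree vanishes) iff for every homogeneous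
`t ∈ T` and nonzero homogeneous `f ∈ F` there is a homogeneous `r ∈ R`
with `t·r = 0` and `f·r ≠ 0`.  Right modules are encoded as modules over `Rᵐᵒᵖ`.
-/

universe u

open DirectSum MulOpposite

/-- Compatibility of a grading on a right `R`-module with the grading of `R`:
`M_i · R_j ⊆ M_{i+j}`. -/
def RGradedSMul {R : Type u} [Ring R] (𝒜 : ℤ → AddSubgroup R)
    {M : Type u} [AddCommGroup M] [Module Rᵐᵒᵖ M] (ℳ : ℤ → AddSubgroup M) : Prop :=
  ∀ ⦃i j : ℤ⦄ ⦃m : M⦄ ⦃r : R⦄, m ∈ ℳ i → r ∈ 𝒜 j → op r • m ∈ ℳ (i + j)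

/-- A submodule is graded if it contains all homogeneous components of its elements. -/
def IsGradedSubmodule {R : Type u} [Ring R]
    {M : Type u} [AddCommGroup M] [Module Rᵐᵒᵖ M] (ℳ : ℤ → AddSubgroup M)
    [DirectSum.Decomposition ℳ] (N : Submodule Rᵐᵒᵖ M) : Prop :=
  ∀ x ∈ N, ∀ i : ℤ, (DirectSum.decompose ℳ x i : M) ∈ N

/-- `E` is graded-injective: every degree-0 map from a graded submodule of a graded
right `R`-module extends to a degree-0 map on the whole module. -/
def GradedInjective {R : Type u} [Ring R] (𝒜 : ℤ → AddSubgroup R)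
    {E : Type u} [AddCommGroup E] [Module Rᵐᵒᵖ E] (ℰ : ℤ → AddSubgroup E) : Prop :=
  ∀ (A : Type u) [AddCommGroup A] [Module Rᵐᵒᵖ A] (ℬ : ℤ → AddSubgroup A)
    [DirectSum.Decomposition ℬ],
    RGradedSMul 𝒜 ℬ →
    ∀ (A' : Submodule Rᵐᵒᵖ A), IsGradedSubmodule ℬ A' →
    ∀ f : A' →ₗ[Rᵐᵒᵖ] E,
      (∀ (i : ℤ) (x : A'), (x : A) ∈ ℬ i → f x ∈ ℰ i) →
      ∃ g : A →ₗ[Rᵐᵒᵖ] E, (∀ i : ℤ, ∀ a ∈ ℬ i, g a ∈ ℰ i) ∧ ∀ x : A', g x = f x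

/-- A graded submodule `F ⊆ E` is graded-essential if it meets every nonzero graded
submodule of `E` nontrivially. -/
def GradedEssential {R : Type u} [Ring R]
    {E : Type u} [AddCommGroup E] [Module Rᵐᵒᵖ E] (ℰ : ℤ → AddSubgroup E)
    [DirectSum.Decomposition ℰ] (F : Submodule Rᵐᵒᵖ E) : Prop :=
  ∀ N : Submodule Rᵐᵒᵖ E, IsGradedSubmodule ℰ N → N ≠ ⊥ → N ⊓ F ≠ ⊥

theorem of_eq_aux {M : Type u} [AddCommGroup M] (ℳ : ℤ → AddSubgroup M) {k l : ℤ} (h : k = l)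
    (x : ℳ k) (y : ℳ l) (hxy : (x : M) = y) :
    DirectSum.of (fun k => ℳ k) k x = DirectSum.of (fun k => ℳ k) l y := by
  subst h
  rw [Subtype.ext hxy]

theorem comp_smul_aux {R : Type u} [Ring R] (𝒜 : ℤ → AddSubgroup R) [GradedRing 𝒜]
    {M : Type u} [AddCommGroup M] [Module Rᵐᵒᵖ M] (ℳ : ℤ → AddSubgroup M)
    [DirectSum.Decomposition ℳ] (hM : RGradedSMul 𝒜 ℳ) {i : ℤ} {m : M} (hm : m ∈ ℳ i)
    (r : R) (k : ℤ) :
    (DirectSum.decompose ℳ (op r • m) k : M)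
      = op (DirectSum.decompose 𝒜 r (k - i) : R) • m := by
  induction r using DirectSum.Decomposition.inductionOn 𝒜 with
  | zero => simp
  | @homogeneous j a =>
    have h := hM hm a.2
    by_cases hk : k = i + j
    · subst hk
      rw [DirectSum.decompose_of_mem_same ℳ h, add_sub_cancel_left,
        DirectSum.decompose_of_mem_same 𝒜 a.2]
    · rw [DirectSum.decompose_of_mem_ne ℳ h (Ne.symm hk),
        DirectSum.decompose_of_mem_ne 𝒜 a.2 (by omega)]
      simp
  | add a b ha hb =>
    simp only [op_add, add_smul, DirectSum.decompose_add, DirectSum.add_apply,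
      AddSubgroup.coe_add, ha, hb]

theorem span_graded_aux {R : Type u} [Ring R] (𝒜 : ℤ → AddSubgroup R) [GradedRing 𝒜]
    {M : Type u} [AddCommGroup M] [Module Rᵐᵒᵖ M] (ℳ : ℤ → AddSubgroup M)
    [DirectSum.Decomposition ℳ] (hM : RGradedSMul 𝒜 ℳ) {i : ℤ} {m : M} (hm : m ∈ ℳ i) :
    IsGradedSubmodule ℳ (Submodule.span Rᵐᵒᵖ {m}) := by
  intro x hx k
  obtain ⟨c, rfl⟩ := Submodule.mem_span_singleton.1 hx
  obtain ⟨r, rfl⟩ := MulOpposite.op_surjective c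
  rw [comp_smul_aux 𝒜 ℳ hM hm]
  exact Submodule.smul_mem _ _ (Submodule.mem_span_singleton_self m)

/-- The shifted grading is again a grading. -/
@[reducible]
noncomputable def shiftDecomp {M : Type u} [AddCommGroup M] (ℳ : ℤ → AddSubgroup M)
    [DirectSum.Decomposition ℳ] (d : ℤ) :
    DirectSum.Decomposition (fun k => ℳ (k - d)) :=
  DirectSum.Decomposition.ofAddHom _
    ((DirectSum.toAddMonoid (fun j =>
      (DirectSum.of (fun k => ℳ (k - d)) (j + d)).comp
        (AddSubgroup.inclusion (le_of_eq (by rw [add_sub_cancel_right]))))).comp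
      (DirectSum.decomposeAddEquiv ℳ).toAddMonoidHom)
    (by
      ext x
      induction x using DirectSum.Decomposition.inductionOn ℳ with
      | zero => simp
      | homogeneous a => simp
      | add a b ha hb => rw [map_add, ha, hb, map_add])
    (by
      ext k x : 2
      have hx : DirectSum.decompose ℳ (x : M) = DirectSum.of (fun k => ℳ k) (k - d) x :=
        DirectSum.decompose_coe ℳ x
      simp [hx]
      exact of_eq_aux _ (by ring) _ _ rfl)

theorem stmt3 {R : Type u} [Ring R] (𝒜 : ℤ → AddSubgroup R) [GradedRing 𝒜]
    {T : Type u} [AddCommGroup T] [Module Rᵐᵒᵖ T] (𝒯 : ℤ → AddSubgroup T)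
    [DirectSum.Decomposition 𝒯] (hT : RGradedSMul 𝒜 𝒯)
    {E : Type u} [AddCommGroup E] [Module Rᵐᵒᵖ E] (ℰ : ℤ → AddSubgroup E)
    [DirectSum.Decomposition ℰ] (hE : RGradedSMul 𝒜 ℰ)
    (hEinj : GradedInjective 𝒜 ℰ)
    (F : Submodule Rᵐᵒᵖ E) (hF : IsGradedSubmodule ℰ F)
    (hFess : GradedEssential ℰ F) :
    (∀ (d : ℤ) (f : T →ₗ[Rᵐᵒᵖ] E), (∀ i : ℤ, ∀ t ∈ 𝒯 i, f t ∈ ℰ (i + d)) → f = 0) ↔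
    (∀ (i : ℤ) (t : T), t ∈ 𝒯 i → ∀ (i' : ℤ) (f : E), f ∈ F → f ∈ ℰ i' → f ≠ 0 →
      ∃ (j : ℤ) (r : R), r ∈ 𝒜 j ∧ op r • t = 0 ∧ op r • f ≠ 0) := by
  constructor
  · intro H i t ht i' f hfF hf hf0
    by_contra! hcon
    have key : ∀ c : Rᵐᵒᵖ, c • t = 0 → c • f = 0 := by
      intro c hc
      obtain ⟨r, rfl⟩ := MulOpposite.op_surjective c
      have h1 : ∀ j, op (DirectSum.decompose 𝒜 r j : R) • f = 0 := by
        intro j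
        apply hcon j _ (SetLike.coe_mem _)
        have := comp_smul_aux 𝒜 𝒯 hT ht r (i + j)
        rw [hc, add_sub_cancel_left] at this
        rw [← this]; simp
      apply (DirectSum.decompose ℰ).injective
      ext k
      rw [comp_smul_aux 𝒜 ℰ hE hf, h1]; simp
    obtain ⟨φ, hφ⟩ : ∃ φ : Submodule.span Rᵐᵒᵖ {t} →ₗ[Rᵐᵒᵖ] E,
        ∀ (c : Rᵐᵒᵖ) (h : c • t ∈ Submodule.span Rᵐᵒᵖ {t}), φ ⟨c • t, h⟩ = c • f :=
      ⟨(LinearPMap.mkSpanSingleton' (σ := RingHom.id Rᵐᵒᵖ) t f key).toFun, fun c h =>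
        LinearPMap.mkSpanSingleton'_apply (σ := RingHom.id Rᵐᵒᵖ) t f key c h⟩
    let _ := shiftDecomp 𝒯 (i' - i)
    have hB : RGradedSMul 𝒜 (fun k => 𝒯 (k - (i' - i))) := by
      intro a b m r hm hr
      have := hT hm hr
      have e : a + b - (i' - i) = a - (i' - i) + b := by ring
      simpa only [e] using this
    have htB : t ∈ (fun k => 𝒯 (k - (i' - i))) i' := by
      simpa using ht
    obtain ⟨g, hg, hgf⟩ := hEinj T (fun k => 𝒯 (k - (i' - i))) hB
      (Submodule.span Rᵐᵒᵖ {t}) (span_graded_aux 𝒜 _ hB htB)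
      φ (by
        rintro k ⟨x, hx⟩ hk
        obtain ⟨c, rfl⟩ := Submodule.mem_span_singleton.1 hx
        obtain ⟨r, rfl⟩ := MulOpposite.op_surjective c
        rw [hφ]
        have e2 := comp_smul_aux 𝒜 _ hB htB r k
        replace e2 := (DirectSum.decompose_of_mem_same (fun k => 𝒯 (k - (i' - i)))
          (x := op r • t) (i := k) hk).symm.trans e2
        have e3 : op (r - (DirectSum.decompose 𝒜 r (k - i') : R)) • f = 0 := by
          apply key
          rw [op_sub, sub_smul, ← e2, sub_self]
        rw [op_sub, sub_smul, sub_eq_zero] at e3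
        rw [e3]
        have := hE hf (SetLike.coe_mem (DirectSum.decompose 𝒜 r (k - i')))
        rwa [add_sub_cancel] at this)
    have hg0 := H (i' - i) g (by
      intro a x hx
      apply hg
      simpa using hx)
    have e := hgf ⟨t, Submodule.mem_span_singleton_self t⟩
    have e' : φ ⟨t, Submodule.mem_span_singleton_self t⟩ = f := by
      simpa using hφ 1 (by simpa using Submodule.mem_span_singleton_self t)
    rw [e', hg0] at e
    exact hf0 e.symm
  · intro H d f hf
    have hhom : ∀ i, ∀ t ∈ 𝒯 i, f t = 0 := by
      intro i t ht
      by_contra hne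
      have he := hf i t ht
      have hN := hFess (Submodule.span Rᵐᵒᵖ {f t}) (span_graded_aux 𝒜 ℰ hE he)
        (by simpa using hne)
      obtain ⟨x, hx, hx0⟩ := Submodule.exists_mem_ne_zero_of_ne_bot hN
      obtain ⟨hx1, hx2⟩ := Submodule.mem_inf.1 hx
      obtain ⟨c, rfl⟩ := Submodule.mem_span_singleton.1 hx1
      obtain ⟨r, rfl⟩ := MulOpposite.op_surjective c
      obtain ⟨k, hk⟩ : ∃ k, (DirectSum.decompose ℰ (op r • f t) k : E) ≠ 0 := by
        by_contra! h
        apply hx0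
        apply (DirectSum.decompose ℰ).injective
        ext k
        rw [h]; simp
      have hkF := hF _ hx2 k
      have hkm := SetLike.coe_mem (DirectSum.decompose ℰ (op r • f t) k)
      rw [comp_smul_aux 𝒜 ℰ hE he] at hk hkF hkm
      obtain ⟨j, s, -, hs1, hs2⟩ := H _ _
        (hT ht (SetLike.coe_mem (DirectSum.decompose 𝒜 r (k - (i + d))))) k _ hkF hkm hk
      apply hs2
      rw [← map_smul, ← map_smul, hs1, map_zero]
    ext x
    induction x using DirectSum.Decomposition.inductionOn 𝒯 with
    | zero => simp
    | @homogeneous j a => simpa using hhom j a a.2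
    | add a b ha hb => rw [map_add, ha, hb, map_add]
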